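/- arXiv:1904.12955 — 6 statements merged into one kernel-verified Lean document; each statement's English description precedes it below -/
import Mathlib

section
/- For every vertex v ∈ ZMod (2n+1) with μ(v) = −1, there exists k ∈ {1, …, 2n} such that μ(v+k) = +1 and the open counterclockwise arc {v+1, …, v+(k−1)} is balanced. (Hence the A-partner of v is well defined as v+k for the least such k.) -/
open Finset

/-- The open counterclockwise arc `{v+1, …, v+(k-1)}` (indexed by `i = 1,…,k-1`) is
balanced: it contains as many elements where `μ = 1` as elements where `μ = -1`. -/
def ArcBalanced (n : ℕ) (μ : ZMod (2*n+1) → ℤ) (v : ZMod (2*n+1)) (k : ℕ) : Prop :=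
  ((Finset.Icc 1 (k-1)).filter fun i : ℕ => μ (v + (i : ZMod (2*n+1))) = 1).card =
  ((Finset.Icc 1 (k-1)).filter fun i : ℕ => μ (v + (i : ZMod (2*n+1))) = -1).card

/-- `k` is a valid cancellation length for an `A`-band at `v`:
`μ (v+k) = 1` and the open arc `{v+1, …, v+(k-1)}` is balanced. -/
def AGood (n : ℕ) (μ : ZMod (2*n+1) → ℤ) (v : ZMod (2*n+1)) (k : ℕ) : Prop :=
  μ (v + (k : ZMod (2*n+1))) = 1 ∧ ArcBalanced n μ v k

/-- `k` is a valid cancellation length for a `B`-band at `v`: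
`μ (v-k) = 1` and the open arc `{v-k+1, …, v-1}` is balanced. -/
def BGood (n : ℕ) (μ : ZMod (2*n+1) → ℤ) (v : ZMod (2*n+1)) (k : ℕ) : Prop :=
  μ (v - (k : ZMod (2*n+1))) = 1 ∧ ArcBalanced n μ (v - (k : ZMod (2*n+1))) k

/-- `w` is the `A`-partner of `v`: `w = v + k` for the least `k ∈ {1,…,2n}` with
`μ (v+k) = 1` and the open arc `{v+1,…,v+(k-1)}` balanced. -/
def IsAPartner (n : ℕ) (μ : ZMod (2*n+1) → ℤ) (v w : ZMod (2*n+1)) : Prop :=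
  ∃ k ∈ Finset.Icc 1 (2*n), AGood n μ v k ∧
    (∀ j ∈ Finset.Icc 1 (2*n), j < k → ¬ AGood n μ v j) ∧ w = v + (k : ZMod (2*n+1))

/-- `w` is the `B`-partner of `v`: `w = v - k` for the least `k ∈ {1,…,2n}` with
`μ (v-k) = 1` and the open arc `{v-k+1,…,v-1}` balanced. -/
def IsBPartner (n : ℕ) (μ : ZMod (2*n+1) → ℤ) (v w : ZMod (2*n+1)) : Prop :=
  ∃ k ∈ Finset.Icc 1 (2*n), BGood n μ v k ∧
    (∀ j ∈ Finset.Icc 1 (2*n), j < k → ¬ BGood n μ v j) ∧ w = v - (k : ZMod (2*n+1))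

/-- The auxiliary graph `G(μ)`: its edges are exactly the unordered pairs
`{v, A-partner of v}` and `{v, B-partner of v}` over all `v` with `μ v = -1`. -/
def G (n : ℕ) (μ : ZMod (2*n+1) → ℤ) : SimpleGraph (ZMod (2*n+1)) :=
  SimpleGraph.fromRel fun x y => μ x = -1 ∧ (IsAPartner n μ x y ∨ IsBPartner n μ x y)

noncomputable instance {n : ℕ} {μ : ZMod (2*n+1) → ℤ} {v : ZMod (2*n+1)} :
    Fintype ((G n μ).neighborSet v) := Fintype.ofFinite _

theorem sum_eq_card_filter_one_sub_card_filter_neg_one {ι : Type*} (s : Finset ι) (f : ι → ℤ)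
    (hf : ∀ i, f i = 1 ∨ f i = -1) :
    ∑ i ∈ s, f i = ((s.filter fun i => f i = 1).card : ℤ) - (s.filter fun i => f i = -1).card := by
  simp only [Finset.card_filter, Nat.cast_sum, ← Finset.sum_sub_distrib]
  refine Finset.sum_congr rfl fun i _ => ?_
  rcases hf i with h | h <;> simp [h]

theorem ZMod.sum_range_add_natCast {M : Type*} [AddCommMonoid M] (m : ℕ) [NeZero m]
    (f : ZMod m → M) (v : ZMod m) :
    ∑ i ∈ Finset.range m, f (v + (i : ZMod m)) = ∑ x, f x := by
  refine Finset.sum_bij' (fun i _ => v + (i : ZMod m)) (fun x _ => (x - v).val) ?_ ?_ ?_ ?_ ?_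
  · simp
  · intro x _
    simpa using ZMod.val_lt (x - v)
  · intro i hi
    simpa using ZMod.val_cast_of_lt (Finset.mem_range.mp hi)
  · simp
  · simp

theorem aPartner_exists (n : ℕ) (μ : ZMod (2*n+1) → ℤ)
    (hn : 0 < n)
    (hval : ∀ v, μ v = 1 ∨ μ v = -1)
    (hplus : (Finset.univ.filter fun v : ZMod (2*n+1) => μ v = 1).card = n + 1)
    (hminus : (Finset.univ.filter fun v : ZMod (2*n+1) => μ v = -1).card = n) :
    ∀ v : ZMod (2*n+1), μ v = -1 →
      ∃ k ∈ Finset.Icc 1 (2*n), μ (v + (k : ZMod (2*n+1))) = 1 ∧ ArcBalanced n μ v k := by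
  intro v hv
  let S : ℕ → ℤ := fun m => ∑ i ∈ Finset.Icc 1 m, μ (v + (i : ZMod (2*n+1)))
  have hS_succ (m : ℕ) : S (m + 1) = S m + μ (v + ((m + 1 : ℕ) : ZMod (2*n+1))) :=
    Finset.sum_Icc_succ_top (by omega) _
  have hS_zero : S 0 = 0 := by simp [S]
  have hS_top : S (2*n) = 2 := by
    have htotal := ZMod.sum_range_add_natCast (2*n+1) μ v
    rw [sum_eq_card_filter_one_sub_card_filter_neg_one _ _ hval, hplus, hminus,
      Finset.range_eq_Ico, Finset.sum_eq_sum_Ico_succ_bot (by omega)] at htotal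
    have hIcc : Finset.Ico (0 + 1) (2*n+1) = Finset.Icc 1 (2*n) := by
      ext i
      simp only [Finset.mem_Ico, Finset.mem_Icc]
      omega
    rw [hIcc, Nat.cast_zero, add_zero, hv] at htotal
    push_cast at htotal
    change -1 + S (2*n) = _ at htotal
    linarith
  have hpos : ∃ m, 0 < S m := ⟨2*n, by omega⟩
  obtain ⟨m, hm⟩ : ∃ m, Nat.find hpos = m + 1 := by
    refine Nat.exists_eq_succ_of_ne_zero fun h => ?_
    have := Nat.find_spec hpos
    rw [h] at this
    omega
  have hle : Nat.find hpos ≤ 2*n := Nat.find_min' hpos (by omega)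
  have hlast : 0 < S (m + 1) := hm ▸ Nat.find_spec hpos
  have hprev : ¬ 0 < S m := Nat.find_min hpos (by omega)
  have hstep := hS_succ m
  have hμ := hval (v + ((m + 1 : ℕ) : ZMod (2*n+1)))
  refine ⟨m + 1, Finset.mem_Icc.mpr ⟨by omega, by omega⟩, by omega, ?_⟩
  have hzero : S m = 0 := by omega
  have hcard := sum_eq_card_filter_one_sub_card_filter_neg_one (Finset.Icc 1 m)
    (fun i : ℕ => μ (v + (i : ZMod (2*n+1)))) fun i => hval _
  change S m = _ at hcard
  rw [ArcBalanced, Nat.add_sub_cancel]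
  omega
end

section
/- If v and v′ are distinct vertices of ZMod (2n+1) with μ(v) = μ(v′) = −1, then the A-partner of v and the A-partner of v′ are distinct; that is, the map sending each vertex with μ = −1 to its A-partner is injective. -/
open Finset

/-- The sum of `μ` over `v+1, …, v+k`. -/
def arcSum (n : ℕ) (μ : ZMod (2*n+1) → ℤ) (v : ZMod (2*n+1)) (k : ℕ) : ℤ :=
  ∑ i ∈ Finset.Icc 1 k, μ (v + (i : ZMod (2*n+1)))

section ArcSum

variable {n : ℕ} {μ : ZMod (2*n+1) → ℤ}

theorem arcSum_zero (v : ZMod (2*n+1)) : arcSum n μ v 0 = 0 := by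
  simp [arcSum]

theorem arcSum_succ (v : ZMod (2*n+1)) (k : ℕ) :
    arcSum n μ v (k + 1) = arcSum n μ v k + μ (v + ((k + 1 : ℕ) : ZMod (2*n+1))) :=
  Finset.sum_Icc_succ_top (by omega) _

theorem arcSum_add (v : ZMod (2*n+1)) (d k : ℕ) :
    arcSum n μ v (d + k) = arcSum n μ v d + arcSum n μ (v + (d : ZMod (2*n+1))) k := by
  induction k with
  | zero => simp [arcSum_zero]
  | succ k ih =>
    rw [← add_assoc, arcSum_succ, arcSum_succ, ih, add_assoc]
    push_cast
    simp only [add_assoc]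

theorem arcBalanced_iff_arcSum_eq_zero (hval : ∀ v, μ v = 1 ∨ μ v = -1)
    (v : ZMod (2*n+1)) (k : ℕ) : ArcBalanced n μ v k ↔ arcSum n μ v (k - 1) = 0 := by
  have hsum : arcSum n μ v (k - 1) =
      (((Finset.Icc 1 (k-1)).filter fun i : ℕ => μ (v + (i : ZMod (2*n+1))) = 1).card : ℤ) -
      ((Finset.Icc 1 (k-1)).filter fun i : ℕ => μ (v + (i : ZMod (2*n+1))) = -1).card := by
    rw [Finset.natCast_card_filter, Finset.natCast_card_filter, ← Finset.sum_sub_distrib]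
    refine Finset.sum_congr rfl fun i _ => ?_
    rcases hval (v + (i : ZMod (2*n+1))) with h | h <;> simp [h]
  rw [hsum, sub_eq_zero, Nat.cast_inj, ArcBalanced]

theorem AGood.arcSum_eq_one (hval : ∀ v, μ v = 1 ∨ μ v = -1) {v : ZMod (2*n+1)} {k : ℕ}
    (hk : 1 ≤ k) (h : AGood n μ v k) : arcSum n μ v k = 1 := by
  obtain ⟨m, rfl⟩ := Nat.exists_eq_add_of_le' hk
  have h0 := (arcBalanced_iff_arcSum_eq_zero hval v (m + 1)).1 h.2
  rw [Nat.add_sub_cancel] at h0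
  rw [arcSum_succ, h0, h.1, zero_add]

/-- Before the first good length, the partial sums of `μ` stay nonpositive. -/
theorem arcSum_nonpos_of_forall_not_aGood (hval : ∀ v, μ v = 1 ∨ μ v = -1)
    {v : ZMod (2*n+1)} {k : ℕ} (h : ∀ j, 1 ≤ j → j < k → ¬ AGood n μ v j) :
    ∀ j < k, arcSum n μ v j ≤ 0 := by
  intro j
  induction j with
  | zero => intro _; rw [arcSum_zero]
  | succ j ih =>
    intro hj
    have hle := ih (by omega)
    rw [arcSum_succ]
    rcases hval (v + ((j + 1 : ℕ) : ZMod (2*n+1))) with h1 | h1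
    · have hne : arcSum n μ v j ≠ 0 := fun h0 =>
        h (j + 1) (by omega) hj ⟨h1, (arcBalanced_iff_arcSum_eq_zero hval v (j + 1)).2 h0⟩
      omega
    · omega

/-- The first good arc from `v` does not share its endpoint with a shorter good arc that starts
at a vertex where `μ` is `-1`. -/
theorem add_natCast_ne_of_lt (hval : ∀ v, μ v = 1 ∨ μ v = -1) {v v' : ZMod (2*n+1)}
    {k k' : ℕ} (hv' : μ v' = -1) (hk : AGood n μ v k)
    (hmin : ∀ j, 1 ≤ j → j < k → ¬ AGood n μ v j) (hk'1 : 1 ≤ k') (hk' : AGood n μ v' k')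
    (hlt : k' < k) : v + (k : ZMod (2*n+1)) ≠ v' + (k' : ZMod (2*n+1)) := by
  intro heq
  obtain ⟨d, rfl⟩ := Nat.exists_eq_add_of_lt hlt
  have hstart : v + ((d + 1 : ℕ) : ZMod (2*n+1)) = v' := by
    push_cast at heq ⊢
    linear_combination heq
  have hd := arcSum_nonpos_of_forall_not_aGood hval hmin d (by omega)
  have htotal := hk.arcSum_eq_one hval (by omega)
  rw [show k' + d + 1 = d + 1 + k' by omega, arcSum_add, arcSum_succ, hstart, hv',
    hk'.arcSum_eq_one hval hk'1] at htotal
  omega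

end ArcSum

theorem aPartner_injective (n : ℕ) (μ : ZMod (2*n+1) → ℤ)
    (hn : 0 < n)
    (hval : ∀ v, μ v = 1 ∨ μ v = -1)
    (hplus : (Finset.univ.filter fun v : ZMod (2*n+1) => μ v = 1).card = n + 1)
    (hminus : (Finset.univ.filter fun v : ZMod (2*n+1) => μ v = -1).card = n) :
    ∀ v v' w w' : ZMod (2*n+1), μ v = -1 → μ v' = -1 → v ≠ v' →
      IsAPartner n μ v w → IsAPartner n μ v' w' → w ≠ w'  := by
  rintro v v' _ _ hv hv' hne ⟨k, hk, hgood, hmin, rfl⟩ ⟨k', hk', hgood', hmin', rfl⟩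
  rw [Finset.mem_Icc] at hk hk'
  rcases lt_trichotomy k k' with hlt | rfl | hlt
  · exact (add_natCast_ne_of_lt hval hv hgood'
      (fun j h1 hj => hmin' j (Finset.mem_Icc.2 ⟨h1, by omega⟩) hj) hk.1 hgood hlt).symm
  · exact fun heq => hne (add_right_cancel heq)
  · exact add_natCast_ne_of_lt hval hv' hgood
      (fun j h1 hj => hmin j (Finset.mem_Icc.2 ⟨h1, by omega⟩) hj) hk'.1 hgood' hlt
end

section
/- Every vertex of the graph G(μ) has degree at most 2. -/
open Finset

/-- A walk with steps `±1` that ends above `0` has an up-step from height `0` to height `1`. -/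
lemma exists_up_step_of_sum_pos (f : ℕ → ℤ) (hf : ∀ i, f i = 1 ∨ f i = -1) (m : ℕ)
    (hm : 0 < ∑ i ∈ range m, f i) :
    ∃ j < m, ∑ i ∈ range j, f i = 0 ∧ f j = 1 := by
  induction m with
  | zero => simp at hm
  | succ m ih =>
    by_cases h : 0 < ∑ i ∈ range m, f i
    · obtain ⟨j, hj, hj'⟩ := ih h
      exact ⟨j, by omega, hj'⟩
    · rw [sum_range_succ] at hm
      refine ⟨m, by omega, ?_⟩
      rcases hf m with h1 | h1 <;> omega

lemma card_filter_eq_iff_sum_eq_zero {α : Type*} (s : Finset α) (g : α → ℤ)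
    (hg : ∀ i, g i = 1 ∨ g i = -1) :
    (s.filter fun i => g i = 1).card = (s.filter fun i => g i = -1).card ↔
      ∑ i ∈ s, g i = 0 := by
  have h : ∑ i ∈ s, g i =
      ((s.filter fun i => g i = 1).card : ℤ) - (s.filter fun i => g i = -1).card := by
    rw [card_filter, card_filter]
    push_cast
    rw [← sum_sub_distrib]
    refine sum_congr rfl fun i _ => ?_
    rcases hg i with h | h <;> simp [h]
  omega

section

variable {n : ℕ} {μ : ZMod (2*n+1) → ℤ}

lemma arcBalanced_succ_iff (hval : ∀ v, μ v = 1 ∨ μ v = -1) (v : ZMod (2*n+1)) (k : ℕ) :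
    ArcBalanced n μ v (k + 1) ↔ ∑ i ∈ range k, μ (v + ((i + 1 : ℕ) : ZMod (2*n+1))) = 0 := by
  unfold ArcBalanced
  rw [card_filter_eq_iff_sum_eq_zero _ (fun i : ℕ => μ (v + (i : ZMod (2*n+1))))
    fun i => hval _, Nat.add_sub_cancel, range_eq_Ico,
    sum_Ico_add' (fun i : ℕ => μ (v + (i : ZMod (2*n+1)))) 0 k 1]
  rfl

lemma arcBalanced_neg_iff (hval : ∀ v, μ v = 1 ∨ μ v = -1) (v : ZMod (2*n+1)) (k : ℕ) :
    ArcBalanced n (fun x => μ (-x)) (-v) (k + 1) ↔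
      ArcBalanced n μ (v - ((k + 1 : ℕ) : ZMod (2*n+1))) (k + 1) := by
  rw [arcBalanced_succ_iff hval, arcBalanced_succ_iff fun v => hval (-v),
    ← sum_range_reflect]
  refine Eq.congr_left (sum_congr rfl fun i hi => congrArg μ ?_)
  have hi' : k - 1 - i + 1 = k - i := by have := mem_range.1 hi; omega
  rw [hi', Nat.cast_sub (mem_range.1 hi).le]
  push_cast
  ring

lemma bGood_iff_aGood_neg (hval : ∀ v, μ v = 1 ∨ μ v = -1) (v : ZMod (2*n+1)) {k : ℕ}
    (hk : 1 ≤ k) : BGood n μ v k ↔ AGood n (fun x => μ (-x)) (-v) k := by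
  obtain ⟨k, rfl⟩ := Nat.exists_eq_add_of_le' hk
  rw [BGood, AGood, arcBalanced_neg_iff hval, neg_add, neg_neg, sub_eq_add_neg]

lemma IsBPartner.isAPartner_neg (hval : ∀ v, μ v = 1 ∨ μ v = -1) {v w : ZMod (2*n+1)}
    (h : IsBPartner n μ v w) : IsAPartner n (fun x => μ (-x)) (-v) (-w) := by
  obtain ⟨k, hk, hg, hmin, rfl⟩ := h
  refine ⟨k, hk, (bGood_iff_aGood_neg hval v (mem_Icc.1 hk).1).1 hg, fun j hj hjk hjg => ?_,
    by ring⟩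
  exact hmin j hj hjk ((bGood_iff_aGood_neg hval v (mem_Icc.1 hj).1).2 hjg)

lemma IsAPartner.apply_eq_one {v w : ZMod (2*n+1)} (h : IsAPartner n μ v w) : μ w = 1 := by
  obtain ⟨k, -, hg, -, rfl⟩ := h
  exact hg.1

lemma IsBPartner.apply_eq_one {v w : ZMod (2*n+1)} (h : IsBPartner n μ v w) : μ w = 1 := by
  obtain ⟨k, -, hg, -, rfl⟩ := h
  exact hg.1

lemma IsAPartner.right_unique {v w w' : ZMod (2*n+1)} (h : IsAPartner n μ v w)
    (h' : IsAPartner n μ v w') : w = w' := by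
  obtain ⟨k, hk, hg, hmin, rfl⟩ := h
  obtain ⟨k', hk', hg', hmin', rfl⟩ := h'
  rcases lt_trichotomy k k' with hlt | rfl | hlt
  · exact absurd hg (hmin' k hk hlt)
  · rfl
  · exact absurd hg' (hmin k' hk' hlt)

/-- If two arcs ending at the same vertex are balanced, then the longer one, when it passes over
the start `v` of the shorter one with `μ v = -1`, contains an earlier good vertex. -/
lemma exists_aGood_lt (hval : ∀ v, μ v = 1 ∨ μ v = -1) {v v' : ZMod (2*n+1)} {k d : ℕ}
    (hv : μ v = -1) (hvv : v = v' + ((d + 1 : ℕ) : ZMod (2*n+1)))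
    (hg : ArcBalanced n μ v (k + 1)) (hg' : ArcBalanced n μ v' (d + 1 + k + 1)) :
    ∃ j < d, AGood n μ v' (j + 1) := by
  rw [arcBalanced_succ_iff hval] at hg hg'
  rw [sum_range_add, sum_range_succ, ← hvv, hv] at hg'
  have hshift : ∑ i ∈ range k, μ (v' + ((d + 1 + i + 1 : ℕ) : ZMod (2*n+1))) = 0 := by
    rw [← hg]
    refine sum_congr rfl fun i _ => congrArg μ ?_
    rw [hvv]
    push_cast
    ring
  obtain ⟨j, hj, hsum, hone⟩ := exists_up_step_of_sum_pos
    (fun i => μ (v' + ((i + 1 : ℕ) : ZMod (2*n+1)))) (fun i => hval _) d (by omega)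
  exact ⟨j, hj, hone, (arcBalanced_succ_iff hval v' j).2 hsum⟩

lemma IsAPartner.left_unique (hval : ∀ v, μ v = 1 ∨ μ v = -1) {v v' w : ZMod (2*n+1)}
    (hv : μ v = -1) (hv' : μ v' = -1) (h : IsAPartner n μ v w) (h' : IsAPartner n μ v' w) :
    v = v' := by
  obtain ⟨k, hk, hg, hmin, rfl⟩ := h
  obtain ⟨k', hk', hg', hmin', heq⟩ := h'
  rw [mem_Icc] at hk hk'
  wlog hle : k ≤ k' generalizing v v' k k'
  · exact (this hv' hv k' hk' hg' hmin' k hk hg hmin heq.symm (by omega)).symm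
  obtain ⟨k, rfl⟩ := Nat.exists_eq_add_of_le' hk.1
  rcases hle.eq_or_lt with rfl | hlt
  · exact add_right_cancel heq
  obtain ⟨d, rfl⟩ : ∃ d, k' = d + 1 + k + 1 := ⟨k' - k - 2, by omega⟩
  have hvv : v = v' + ((d + 1 : ℕ) : ZMod (2*n+1)) := by
    push_cast at heq ⊢
    linear_combination heq
  obtain ⟨j, hj, hjg⟩ := exists_aGood_lt hval hv hvv hg.2 hg'.2
  exact absurd hjg (hmin' (j + 1) (mem_Icc.2 ⟨by omega, by omega⟩) (by omega))

lemma IsBPartner.right_unique (hval : ∀ v, μ v = 1 ∨ μ v = -1) {v w w' : ZMod (2*n+1)}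
    (h : IsBPartner n μ v w) (h' : IsBPartner n μ v w') : w = w' :=
  neg_injective ((h.isAPartner_neg hval).right_unique (h'.isAPartner_neg hval))

lemma IsBPartner.left_unique (hval : ∀ v, μ v = 1 ∨ μ v = -1) {v v' w : ZMod (2*n+1)}
    (hv : μ v = -1) (hv' : μ v' = -1) (h : IsBPartner n μ v w) (h' : IsBPartner n μ v' w) :
    v = v' :=
  neg_injective <| IsAPartner.left_unique (fun v => hval (-v)) (by simpa using hv)
    (by simpa using hv') (h.isAPartner_neg hval) (h'.isAPartner_neg hval)

end

lemma card_le_two_of_subsingleton_cover {α : Type*} (s : Finset α) (P Q : α → Prop)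
    (hs : ∀ x ∈ s, P x ∨ Q x) (hP : ∀ x y, P x → P y → x = y)
    (hQ : ∀ x y, Q x → Q y → x = y) : s.card ≤ 2 := by
  by_contra! h
  obtain ⟨a, b, c, ha, hb, hc, hab, hac, hbc⟩ := two_lt_card.1 h
  grind

theorem degree_le_two (n : ℕ) (μ : ZMod (2*n+1) → ℤ)
    (hn : 0 < n)
    (hval : ∀ v, μ v = 1 ∨ μ v = -1)
    (hplus : (Finset.univ.filter fun v : ZMod (2*n+1) => μ v = 1).card = n + 1)
    (hminus : (Finset.univ.filter fun v : ZMod (2*n+1) => μ v = -1).card = n) :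
    ∀ v : ZMod (2*n+1), (G n μ).degree v ≤ 2 := by
  intro v
  rw [← SimpleGraph.card_neighborFinset_eq_degree]
  have hadj : ∀ w ∈ (G n μ).neighborFinset v,
      (μ v = -1 ∧ (IsAPartner n μ v w ∨ IsBPartner n μ v w)) ∨
      (μ w = -1 ∧ (IsAPartner n μ w v ∨ IsBPartner n μ w v)) := fun w hw => by
    rw [SimpleGraph.mem_neighborFinset] at hw
    exact ((SimpleGraph.fromRel_adj _ _ _).1 hw).2
  rcases hval v with hv | hv
  · refine card_le_two_of_subsingleton_cover _ (fun w => μ w = -1 ∧ IsAPartner n μ w v)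
      (fun w => μ w = -1 ∧ IsBPartner n μ w v) (fun w hw => ?_)
      (fun x y hx hy => hx.2.left_unique hval hx.1 hy.1 hy.2)
      (fun x y hx hy => hx.2.left_unique hval hx.1 hy.1 hy.2)
    rcases hadj w hw with h | h
    · omega
    · exact and_or_left.1 h
  · refine card_le_two_of_subsingleton_cover _ (IsAPartner n μ v) (IsBPartner n μ v)
      (fun w hw => ?_) (fun x y hx hy => hx.right_unique hy)
      (fun x y hx hy => hx.right_unique hval hy)
    rcases hadj w hw with h | ⟨-, h | h⟩
    · exact h.2
    · have := h.apply_eq_one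
      omega
    · have := h.apply_eq_one
      omega
end

section
/- (Proposition 2.2.) The graph G(μ) is a path on its 2n+1 vertices: there exists a bijection σ : Fin (2n+1) → ZMod (2n+1) such that two vertices x, y are adjacent in G(μ) if and only if {x, y} = {σ(i), σ(i+1)} for some i with 0 ≤ i < 2n. -/
open Finset

/-- The height function of `μ` on the universal cover `ℤ` of the cycle. -/
lemma exists_height (n : ℕ) (μ : ZMod (2*n+1) → ℤ) (hsum : ∑ v, μ v = 1) :
    ∃ h : ℤ → ℤ, (∀ i : ℤ, h (i + 1) = h i + μ (i : ZMod (2*n+1))) ∧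
      ∀ i c : ℤ, h (i + (2*n+1) * c) = h i + c := by
  have hrange : ∑ j ∈ Finset.range (2*n+1), μ ((j : ℕ) : ZMod (2*n+1)) = 1 := by
    rw [← Fin.sum_univ_eq_sum_range (fun j : ℕ => μ (j : ZMod (2*n+1))), ← hsum]
    refine Finset.sum_congr rfl fun i _ => ?_
    exact congrArg μ (ZMod.natCast_zmod_val (n := 2*n+1) i)
  have hN : (0 : ℤ) < 2*n+1 := by positivity
  refine ⟨fun i => i / (2*n+1) + ∑ j ∈ Finset.range (i % (2*n+1)).toNat,
    μ ((j : ℕ) : ZMod (2*n+1)), fun i => ?_, fun i c => ?_⟩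
  · obtain ⟨q, r, hr0, hrN, rfl⟩ : ∃ q r : ℤ, 0 ≤ r ∧ r < 2*n+1 ∧ i = r + (2*n+1) * q :=
      ⟨i / (2*n+1), i % (2*n+1), Int.emod_nonneg _ hN.ne', Int.emod_lt_of_pos _ hN,
        (Int.emod_add_mul_ediv _ _).symm⟩
    lift r to ℕ using hr0
    have hcast : (((r : ℤ) + (2*n+1) * q : ℤ) : ZMod (2*n+1)) = (r : ZMod (2*n+1)) := by
      have h0 : ((2*n+1 : ℕ) : ZMod (2*n+1)) = 0 := ZMod.natCast_self _
      push_cast at h0 ⊢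
      rw [h0]; ring
    have hshift : (r : ℤ) + (2*n+1) * q + 1 = (r + 1) + (2*n+1) * q := by ring
    simp only [hcast, hshift, Int.add_mul_emod_self_left, Int.add_mul_ediv_left _ _ hN.ne']
    rw [Int.emod_eq_of_lt (by omega) hrN, Int.ediv_eq_zero_of_lt (by omega) hrN]
    rcases lt_or_eq_of_le (show (r : ℤ) + 1 ≤ 2*n+1 by omega) with hlt | heq
    · rw [Int.emod_eq_of_lt (by omega) hlt, Int.ediv_eq_zero_of_lt (by omega) hlt]
      rw [show ((r : ℤ) + 1).toNat = r + 1 by omega, Finset.sum_range_succ]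
      simp [add_assoc]
    · have hr : r + 1 = 2*n+1 := by omega
      have hsplit := Finset.sum_range_succ (fun j : ℕ => μ (j : ZMod (2*n+1))) r
      rw [hr, hrange] at hsplit
      rw [heq, Int.emod_self, Int.ediv_self hN.ne']
      simp only [Int.toNat_zero, Finset.range_zero, Finset.sum_empty, Int.toNat_natCast]
      linarith
  · simp only [Int.add_mul_emod_self_left, Int.add_mul_ediv_left _ _ hN.ne']
    ring

lemma arcBalanced_iff_height_eq (n : ℕ) (μ : ZMod (2*n+1) → ℤ)
    (hval : ∀ v, μ v = 1 ∨ μ v = -1) (h : ℤ → ℤ)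
    (hstep : ∀ i : ℤ, h (i + 1) = h i + μ (i : ZMod (2*n+1))) (a : ℤ) (k : ℕ) (hk : 1 ≤ k) :
    ArcBalanced n μ (a : ZMod (2*n+1)) k ↔ h (a + k) = h (a + 1) := by
  obtain ⟨m, rfl⟩ : ∃ m, k = m + 1 := ⟨k - 1, by omega⟩
  have key : ∀ m : ℕ, h (a + (m + 1 : ℕ)) = h (a + 1) +
      (((Finset.Icc 1 m).filter fun i : ℕ => μ ((a : ZMod (2*n+1)) + (i : ZMod (2*n+1))) = 1).card
        : ℤ) -
      ((Finset.Icc 1 m).filter fun i : ℕ =>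
        μ ((a : ZMod (2*n+1)) + (i : ZMod (2*n+1))) = -1).card := by
    intro m
    induction m with
    | zero => simp
    | succ m ih =>
      have hs := hstep (a + (m + 1 : ℕ))
      rw [show a + ((m + 1 : ℕ) : ℤ) + 1 = a + ((m + 1 + 1 : ℕ) : ℤ) by push_cast; ring, ih] at hs
      rw [hs, Finset.card_filter, Finset.card_filter, Finset.card_filter, Finset.card_filter,
        Finset.sum_Icc_succ_top (by omega), Finset.sum_Icc_succ_top (by omega)]
      have hcast : ((a + (m + 1 : ℕ) : ℤ) : ZMod (2*n+1)) = a + ((m + 1 : ℕ) : ZMod (2*n+1)) := by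
        push_cast; rfl
      rw [hcast]
      rcases hval (a + ((m + 1 : ℕ) : ZMod (2*n+1))) with h1 | h1 <;> rw [h1] <;> simp <;> ring
  rw [key m, ArcBalanced, Nat.add_sub_cancel]
  omega

/-- Discrete intermediate value theorem, for a crossing of the edge from `0` to `1`. -/
lemma exists_up_crossing (h : ℤ → ℤ) (hstep : ∀ i, h (i + 1) = h i + 1 ∨ h (i + 1) = h i - 1)
    (a b : ℤ) (hab : a ≤ b) (ha : h a ≤ 0) (hb : 1 ≤ h b) :
    ∃ i, a ≤ i ∧ i < b ∧ h i = 0 ∧ h (i + 1) = 1 := by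
  induction b, hab using Int.leInduction with
  | base => omega
  | succ b hab ih =>
    by_cases hc : 1 ≤ h b
    · obtain ⟨i, hi⟩ := ih hc
      exact ⟨i, by omega⟩
    · exact ⟨b, hab, by omega, by have := hstep b; omega⟩

lemma exists_down_crossing (h : ℤ → ℤ) (hstep : ∀ i, h (i + 1) = h i + 1 ∨ h (i + 1) = h i - 1)
    (a b : ℤ) (hab : a ≤ b) (ha : 1 ≤ h a) (hb : h b ≤ 0) :
    ∃ i, a ≤ i ∧ i < b ∧ h i = 1 ∧ h (i + 1) = 0 := by
  obtain ⟨i, hi⟩ := exists_up_crossing (fun i => 1 - h i)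
    (fun i => by have := hstep i; omega) a b hab (by omega) (by omega)
  exact ⟨i, by omega⟩

/-- Each vertex has exactly one lift whose step crosses the edge between heights `0` and `1`. -/
lemma exists_lift (n : ℕ) (h : ℤ → ℤ) (hper : ∀ i c : ℤ, h (i + (2*n+1) * c) = h i + c) :
    ∃ t : ZMod (2*n+1) → ℤ, (∀ x, ((t x : ℤ) : ZMod (2*n+1)) = x) ∧
      (∀ x, min (h (t x)) (h (t x + 1)) = 0) ∧
      ∀ i : ℤ, min (h i) (h (i + 1)) = 0 → t (i : ZMod (2*n+1)) = i := by
  have hex : ∀ x : ZMod (2*n+1), ∃ i : ℤ, (i : ZMod (2*n+1)) = x ∧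
      min (h i) (h (i + 1)) = 0 := by
    intro x
    obtain ⟨j, rfl⟩ := ZMod.intCast_surjective x
    refine ⟨j + (2*n+1) * (-min (h j) (h (j + 1))), ?_, ?_⟩
    · have h0 : ((2*n+1 : ℕ) : ZMod (2*n+1)) = 0 := ZMod.natCast_self _
      push_cast at h0 ⊢
      rw [h0]; ring
    · rw [add_right_comm, hper, hper]
      omega
  choose t ht hmin using hex
  refine ⟨t, ht, hmin, fun i hi => ?_⟩
  obtain ⟨c, hc⟩ := (ZMod.intCast_eq_intCast_iff_dvd_sub i (t i) (2*n+1)).mp (ht i).symm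
  have hti : t i = i + (2*n+1) * c := by push_cast at hc; linarith
  have hm := hmin i
  rw [hti, add_right_comm, hper, hper] at hm
  have hc0 : c = 0 := by omega
  rw [hti, hc0]; ring

lemma isAPartner_iff (n : ℕ) (μ : ZMod (2*n+1) → ℤ)
    (hval : ∀ v, μ v = 1 ∨ μ v = -1) (h : ℤ → ℤ)
    (hstep : ∀ i : ℤ, h (i + 1) = h i + μ (i : ZMod (2*n+1)))
    (hper : ∀ i c : ℤ, h (i + (2*n+1) * c) = h i + c)
    (t : ZMod (2*n+1) → ℤ) (ht : ∀ x, ((t x : ℤ) : ZMod (2*n+1)) = x)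
    (hmin : ∀ x, min (h (t x)) (h (t x + 1)) = 0)
    (huniq : ∀ i : ℤ, min (h i) (h (i + 1)) = 0 → t (i : ZMod (2*n+1)) = i)
    (x y : ZMod (2*n+1)) (hx : μ x = -1) :
    IsAPartner n μ x y ↔ t x < t y ∧ ∀ z, t x < t z → t y ≤ t z := by
  have hstep' : ∀ i, h (i + 1) = h i + 1 ∨ h (i + 1) = h i - 1 := fun i => by
    have := hstep i; have := hval i; omega
  have hsx := hstep (t x)
  rw [ht, hx] at hsx
  have hmx := hmin x
  have good : ∀ k : ℕ, 1 ≤ k → (AGood n μ x k ↔ h (t x + k) = 0 ∧ h (t x + k + 1) = 1) := by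
    intro k hk
    have hb := arcBalanced_iff_height_eq n μ hval h hstep (t x) k hk
    have hs := hstep (t x + k)
    push_cast at hs
    rw [ht] at hb hs
    rw [AGood, hb]
    omega
  constructor
  · rintro ⟨k, hk, hg, hleast, rfl⟩
    rw [Finset.mem_Icc] at hk
    rw [good k hk.1] at hg
    have hty : t (x + (k : ZMod (2*n+1))) = t x + k := by
      have := huniq (t x + k) (by omega)
      push_cast at this
      rwa [ht] at this
    rw [hty]
    refine ⟨by omega, fun z hz => ?_⟩
    by_contra! hlt
    have hmz := hmin z
    have hsz := hstep' (t z)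
    obtain ⟨i, hi1, hi2, hi3, hi4⟩ : ∃ i, t x < i ∧ i < t x + k ∧ h i = 0 ∧ h (i + 1) = 1 := by
      by_cases hup : h (t z) = 0
      · exact ⟨t z, by omega⟩
      · obtain ⟨i, hi⟩ := exists_up_crossing h hstep' (t x + 1) (t z) (by omega) (by omega)
          (by omega)
        exact ⟨i, by omega⟩
    obtain ⟨j, rfl⟩ : ∃ j : ℕ, i = t x + j := ⟨(i - t x).toNat, by omega⟩
    exact hleast j (Finset.mem_Icc.mpr (by omega)) (by omega) ((good j (by omega)).mpr ⟨hi3, hi4⟩)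
  · rintro ⟨hlt, hnext⟩
    have hnext' : ∀ i, t x < i → h i = 0 → h (i + 1) = 1 → t y ≤ i := fun i hi h0 h1 => by
      have hti := huniq i (by omega)
      have := hnext i (by omega)
      omega
    have hpx := hper (t x) 1
    rw [mul_one] at hpx
    have hmy := hmin y
    have hsy := hstep' (t y)
    obtain ⟨i, hi1, hi2, hi3, hi4⟩ := exists_up_crossing h hstep' (t x + 1) (t x + (2*n+1))
      (by omega) (by omega) (by omega)
    have hbound := hnext' i (by omega) hi3 hi4
    have hup : h (t y) = 0 := by
      by_contra hne
      obtain ⟨i, hi1, hi2, hi3, hi4⟩ := exists_up_crossing h hstep' (t x + 1) (t y)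
        (by omega) (by omega) (by omega)
      have := hnext' i (by omega) hi3 hi4
      omega
    obtain ⟨k, hk⟩ : ∃ k : ℕ, t y = t x + k := ⟨(t y - t x).toNat, by omega⟩
    refine ⟨k, Finset.mem_Icc.mpr (by omega), (good k (by omega)).mpr ?_, fun j hj hjk hg => ?_, ?_⟩
    · rw [← hk]; omega
    · rw [Finset.mem_Icc] at hj
      rw [good j hj.1] at hg
      have := hnext' (t x + j) (by omega) hg.1 hg.2
      omega
    · rw [← ht y, hk]; push_cast; rw [ht]

lemma isBPartner_iff (n : ℕ) (μ : ZMod (2*n+1) → ℤ)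
    (hval : ∀ v, μ v = 1 ∨ μ v = -1) (h : ℤ → ℤ)
    (hstep : ∀ i : ℤ, h (i + 1) = h i + μ (i : ZMod (2*n+1)))
    (hper : ∀ i c : ℤ, h (i + (2*n+1) * c) = h i + c)
    (t : ZMod (2*n+1) → ℤ) (ht : ∀ x, ((t x : ℤ) : ZMod (2*n+1)) = x)
    (hmin : ∀ x, min (h (t x)) (h (t x + 1)) = 0)
    (huniq : ∀ i : ℤ, min (h i) (h (i + 1)) = 0 → t (i : ZMod (2*n+1)) = i)
    (x y : ZMod (2*n+1)) (hx : μ x = -1) :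
    IsBPartner n μ x y ↔ t y < t x ∧ ∀ z, t z < t x → t z ≤ t y := by
  have hstep' : ∀ i, h (i + 1) = h i + 1 ∨ h (i + 1) = h i - 1 := fun i => by
    have := hstep i; have := hval i; omega
  have hsx := hstep (t x)
  rw [ht, hx] at hsx
  have hmx := hmin x
  have good : ∀ k : ℕ, 1 ≤ k → (BGood n μ x k ↔ h (t x - k) = 0 ∧ h (t x - k + 1) = 1) := by
    intro k hk
    have hb := arcBalanced_iff_height_eq n μ hval h hstep (t x - k) k hk
    have hs := hstep (t x - k)
    push_cast at hs hb
    rw [ht] at hb hs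
    rw [sub_add_cancel] at hb
    rw [BGood, hb]
    omega
  constructor
  · rintro ⟨k, hk, hg, hleast, rfl⟩
    rw [Finset.mem_Icc] at hk
    rw [good k hk.1] at hg
    have hty : t (x - (k : ZMod (2*n+1))) = t x - k := by
      have := huniq (t x - k) (by omega)
      push_cast at this
      rwa [ht] at this
    rw [hty]
    refine ⟨by omega, fun z hz => ?_⟩
    by_contra! hlt
    have hmz := hmin z
    have hsz := hstep' (t z)
    obtain ⟨i, hi1, hi2, hi3, hi4⟩ : ∃ i, t x - k < i ∧ i < t x ∧ h i = 0 ∧ h (i + 1) = 1 := by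
      by_cases hup : h (t z) = 0
      · exact ⟨t z, by omega⟩
      · obtain ⟨i, hi⟩ := exists_up_crossing h hstep' (t z + 1) (t x) (by omega) (by omega)
          (by omega)
        exact ⟨i, by omega⟩
    obtain ⟨j, rfl⟩ : ∃ j : ℕ, i = t x - j := ⟨(t x - i).toNat, by omega⟩
    exact hleast j (Finset.mem_Icc.mpr (by omega)) (by omega) ((good j (by omega)).mpr ⟨hi3, hi4⟩)
  · rintro ⟨hlt, hprev⟩
    have hprev' : ∀ i, i < t x → h i = 0 → h (i + 1) = 1 → i ≤ t y := fun i hi h0 h1 => by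
      have hti := huniq i (by omega)
      have := hprev i (by omega)
      omega
    have hpx := hper (t x + 1) (-1)
    rw [mul_neg_one] at hpx
    have hmy := hmin y
    have hsy := hstep' (t y)
    obtain ⟨i, hi1, hi2, hi3, hi4⟩ := exists_up_crossing h hstep' (t x + 1 + -(2*n+1)) (t x)
      (by omega) (by omega) (by omega)
    have hbound := hprev' i (by omega) hi3 hi4
    have hup : h (t y) = 0 := by
      by_contra hne
      obtain ⟨i, hi1, hi2, hi3, hi4⟩ := exists_up_crossing h hstep' (t y + 1) (t x)
        (by omega) (by omega) (by omega)
      have := hprev' i (by omega) hi3 hi4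
      omega
    obtain ⟨k, hk⟩ : ∃ k : ℕ, t y = t x - k := ⟨(t x - t y).toNat, by omega⟩
    refine ⟨k, Finset.mem_Icc.mpr (by omega), (good k (by omega)).mpr ?_, fun j hj hjk hg => ?_, ?_⟩
    · rw [← hk]; omega
    · rw [Finset.mem_Icc] at hj
      rw [good j hj.1] at hg
      have := hprev' (t x - j) (by omega) hg.1 hg.2
      omega
    · rw [← ht y, hk]; push_cast; rw [ht]

/-- Two vertices are adjacent iff their lifts are consecutive crossings of the same edge. -/
lemma adj_iff_consecutive (n : ℕ) (μ : ZMod (2*n+1) → ℤ)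
    (hval : ∀ v, μ v = 1 ∨ μ v = -1) (h : ℤ → ℤ)
    (hstep : ∀ i : ℤ, h (i + 1) = h i + μ (i : ZMod (2*n+1)))
    (hper : ∀ i c : ℤ, h (i + (2*n+1) * c) = h i + c)
    (t : ZMod (2*n+1) → ℤ) (ht : ∀ x, ((t x : ℤ) : ZMod (2*n+1)) = x)
    (hmin : ∀ x, min (h (t x)) (h (t x + 1)) = 0)
    (huniq : ∀ i : ℤ, min (h i) (h (i + 1)) = 0 → t (i : ZMod (2*n+1)) = i)
    (x y : ZMod (2*n+1)) :
    (G n μ).Adj x y ↔ (t x < t y ∧ ∀ z, t x < t z → t y ≤ t z) ∨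
      (t y < t x ∧ ∀ z, t y < t z → t x ≤ t z) := by
  have hstep' : ∀ i, h (i + 1) = h i + 1 ∨ h (i + 1) = h i - 1 := fun i => by
    have := hstep i; have := hval i; omega
  have hA := isAPartner_iff n μ hval h hstep hper t ht hmin huniq
  have hB := isBPartner_iff n μ hval h hstep hper t ht hmin huniq
  have hflip : ∀ x y, (t y < t x ∧ ∀ z, t z < t x → t z ≤ t y) ↔
      (t y < t x ∧ ∀ z, t y < t z → t x ≤ t z) := fun x y =>
    and_congr_right fun _ => forall_congr' fun z => by
      constructor <;> intro H H' <;> by_contra! hc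
      · have := H hc; omega
      · have := H hc; omega
  have hsign : ∀ x y, (t x < t y ∧ ∀ z, t x < t z → t y ≤ t z) → μ x = -1 ∨ μ y = -1 := by
    rintro x y ⟨hlt, hnext⟩
    by_contra! hc
    have hx := (hval x).resolve_right hc.1
    have hy := (hval y).resolve_right hc.2
    have hsx := hstep (t x)
    have hsy := hstep (t y)
    rw [ht] at hsx hsy
    have hmx := hmin x
    have hmy := hmin y
    obtain ⟨i, hi1, hi2, hi3, hi4⟩ := exists_down_crossing h hstep' (t x + 1) (t y)
      (by omega) (by omega) (by omega)
    have hti := huniq i (by omega)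
    have := hnext i (by omega)
    omega
  rw [G, SimpleGraph.fromRel_adj]
  constructor
  · rintro ⟨-, ⟨hx, hAB⟩ | ⟨hy, hAB⟩⟩
    · rw [hA x y hx, hB x y hx, hflip] at hAB
      exact hAB
    · rw [hA y x hy, hB y x hy, hflip] at hAB
      exact hAB.symm
  · intro H
    refine ⟨?_, ?_⟩
    · rintro rfl
      rcases H with H | H <;> exact lt_irrefl _ H.1
    · have hs : μ x = -1 ∨ μ y = -1 := H.elim (hsign x y) fun H => (hsign y x H).symm
      rcases hs with hx | hy
      · left
        rw [hA x y hx, hB x y hx, hflip]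
        exact ⟨hx, H⟩
      · right
        rw [hA y x hy, hB y x hy, hflip]
        exact ⟨hy, H.symm⟩

/-- A finite type with an injection into a linear order can be enumerated increasingly. -/
lemma exists_equiv_strictMono {α β : Type*} [Fintype α] [LinearOrder β] {m : ℕ}
    (hm : Fintype.card α = m) (t : α → β) (ht : Function.Injective t) :
    ∃ σ : Fin m ≃ α, StrictMono fun i => t (σ i) := by
  let _ : LinearOrder α := LinearOrder.lift' t ht
  exact ⟨(Fintype.orderIsoFinOfCardEq α hm).toEquiv,
    fun i j hij => (Fintype.orderIsoFinOfCardEq α hm).strictMono hij⟩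

theorem isPath (n : ℕ) (μ : ZMod (2*n+1) → ℤ)
    (hn : 0 < n)
    (hval : ∀ v, μ v = 1 ∨ μ v = -1)
    (hplus : (Finset.univ.filter fun v : ZMod (2*n+1) => μ v = 1).card = n + 1)
    (hminus : (Finset.univ.filter fun v : ZMod (2*n+1) => μ v = -1).card = n) :
    ∃ σ : Fin (2*n+1) ≃ ZMod (2*n+1), ∀ x y : ZMod (2*n+1),
      (G n μ).Adj x y ↔ ∃ i : Fin (2*n), s(x, y) = s(σ i.castSucc, σ i.succ) := by
  have hsum : ∑ v, μ v = 1 := by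
    have hμ : ∀ v, μ v = (if μ v = 1 then 1 else 0) - (if μ v = -1 then 1 else 0) := fun v => by
      rcases hval v with hv | hv <;> simp [hv]
    rw [Finset.sum_congr rfl fun v _ => hμ v, Finset.sum_sub_distrib, Finset.sum_boole,
      Finset.sum_boole, hplus, hminus]
    push_cast; ring
  obtain ⟨h, hstep, hper⟩ := exists_height n μ hsum
  obtain ⟨t, ht, hmin, huniq⟩ := exists_lift n h hper
  obtain ⟨σ, hσ⟩ := exists_equiv_strictMono (ZMod.card (2*n+1)) t
    (Function.LeftInverse.injective (g := fun i : ℤ => (i : ZMod (2*n+1))) ht)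
  have hcons : ∀ a b, (t (σ a) < t (σ b) ∧ ∀ z, t (σ a) < t z → t (σ b) ≤ t z) ↔
      ∃ i : Fin (2*n), a = i.castSucc ∧ b = i.succ := by
    intro a b
    rw [σ.surjective.forall]
    simp only [hσ.lt_iff_lt, hσ.le_iff_le]
    constructor
    · rintro ⟨hab, hnext⟩
      have hlt : a.val < 2*n := by omega
      have := hnext ⟨a.val + 1, by omega⟩ (Fin.lt_def.mpr (Nat.lt_succ_self _))
      rw [Fin.le_def] at this
      rw [Fin.lt_def] at hab
      exact ⟨⟨a.val, hlt⟩, rfl, Fin.ext (le_antisymm this hab)⟩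
    · rintro ⟨i, rfl, rfl⟩
      exact ⟨Fin.castSucc_lt_succ, fun c hc => Fin.castSucc_lt_iff_succ_le.mp hc⟩
  refine ⟨σ, fun x y => ?_⟩
  obtain ⟨a, rfl⟩ := σ.surjective x
  obtain ⟨b, rfl⟩ := σ.surjective y
  rw [adj_iff_consecutive n μ hval h hstep hper t ht hmin huniq, hcons a b, hcons b a, ← exists_or]
  simp only [Sym2.eq_iff, σ.injective.eq_iff]
  exact exists_congr fun i => or_congr_right and_comm
end

section
/- A vertex w of G(μ) has degree 1 if and only if μ(w) = +1 and w is either not the A-partner of any vertex or not the B-partner of any vertex; moreover the unique vertex with μ = +1 that is not an A-partner is distinct from the unique vertex with μ = +1 that is not a B-partner, so G(μ) has exactly two vertices of degree 1. -/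
open Finset

namespace Cancellation

variable {n : ℕ} {μ : ZMod (2*n+1) → ℤ} {ε v w : ZMod (2*n+1)} {k : ℕ}

/-- The sum of `μ` over the `k` vertices `v, v + ε, …, v + (k-1) ε`. -/
def arcSum (μ : ZMod (2*n+1) → ℤ) (ε v : ZMod (2*n+1)) (k : ℕ) : ℤ :=
  ∑ i ∈ range k, μ (v + ε * (i : ZMod (2*n+1)))

/-- `w` is the first vertex in direction `ε` at which the sum of `μ` starting at `v`
vanishes, all earlier sums being negative. -/
def IsPartner (μ : ZMod (2*n+1) → ℤ) (ε v w : ZMod (2*n+1)) : Prop :=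
  ∃ k : ℕ, 1 ≤ k ∧ k ≤ 2 * n ∧ arcSum μ ε v (k + 1) = 0 ∧
    (∀ j, 1 ≤ j → j ≤ k → arcSum μ ε v j < 0) ∧ w = v + ε * (k : ZMod (2*n+1))

lemma arcSum_one : arcSum μ ε v 1 = μ v := by simp [arcSum]

lemma arcSum_succ (k : ℕ) :
    arcSum μ ε v (k + 1) = arcSum μ ε v k + μ (v + ε * (k : ZMod (2*n+1))) :=
  sum_range_succ _ _

lemma arcSum_add (a b : ℕ) :
    arcSum μ ε v (a + b) = arcSum μ ε v a + arcSum μ ε (v + ε * (a : ZMod (2*n+1))) b := by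
  simp only [arcSum, sum_range_add]
  congr 1
  refine sum_congr rfl fun i _ => ?_
  push_cast
  ring_nf

lemma arcSum_reverse (k : ℕ) :
    arcSum μ (-ε) (v + ε * (k : ZMod (2*n+1))) (k + 1) = arcSum μ ε v (k + 1) := by
  unfold arcSum
  rw [← sum_range_reflect]
  refine sum_congr rfl fun i hi => ?_
  have hi : i ≤ k := by simpa [Nat.lt_succ_iff] using hi
  rw [show k + 1 - 1 - i = k - i by omega, Nat.cast_sub hi]
  ring_nf

lemma arcSum_full (hε : ε * ε = 1) (htot : ∑ x, μ x = 1) (v : ZMod (2*n+1)) :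
    arcSum μ ε v (2 * n + 1) = 1 := by
  have hcast : arcSum μ ε v (2 * n + 1) = ∑ x : ZMod (2*n+1), μ (v + ε * x) := by
    unfold arcSum
    refine sum_nbij' (fun i => (i : ZMod (2*n+1))) ZMod.val ?_ ?_ ?_ ?_ ?_
    · simp
    · intro x _
      simpa using ZMod.val_lt x
    · intro i hi
      exact ZMod.val_cast_of_lt (mem_range.1 hi)
    · intro x _
      simp
    · simp
  rw [hcast, ← htot]
  refine sum_nbij' (fun x => v + ε * x) (fun y => ε * (y - v)) ?_ ?_ ?_ ?_ ?_
  · simp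
  · simp
  · intro x _
    linear_combination x * hε
  · intro y _
    linear_combination (y - v) * hε
  · simp

lemma exists_isPartner (hval : ∀ v, μ v = 1 ∨ μ v = -1) (hε : ε * ε = 1)
    (htot : ∑ x, μ x = 1) (hv : μ v = -1) : ∃ w, IsPartner μ ε v w := by
  classical
  have hex : ∃ k, 0 ≤ arcSum μ ε v (k + 1) := ⟨2 * n, by rw [arcSum_full hε htot]; norm_num⟩
  have hle : Nat.find hex ≤ 2 * n :=
    Nat.find_min' hex (by rw [arcSum_full hε htot]; norm_num)
  have hspec := Nat.find_spec hex
  have hmin : ∀ j, j < Nat.find hex → arcSum μ ε v (j + 1) < 0 := fun j hj =>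
    not_le.1 (Nat.find_min hex hj)
  generalize Nat.find hex = k at *
  have hk : 1 ≤ k := by
    rcases Nat.eq_zero_or_pos k with rfl | h
    · rw [zero_add, arcSum_one] at hspec
      omega
    · exact h
  have hneg : ∀ j, 1 ≤ j → j ≤ k → arcSum μ ε v j < 0 := fun j h1 h2 => by
    have := hmin (j - 1) (by omega)
    rwa [Nat.sub_add_cancel h1] at this
  refine ⟨_, k, hk, hle, ?_, hneg, rfl⟩
  have h1 := hneg k hk le_rfl
  rw [arcSum_succ] at hspec ⊢
  rcases hval (v + ε * (k : ZMod (2*n+1))) with h | h <;> omega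

lemma IsPartner.apply_left (hval : ∀ v, μ v = 1 ∨ μ v = -1) (h : IsPartner μ ε v w) :
    μ v = -1 := by
  obtain ⟨k, hk, -, -, hneg, -⟩ := h
  have := hneg 1 le_rfl hk
  rw [arcSum_one] at this
  have := hval v
  omega

lemma IsPartner.apply_right (hval : ∀ v, μ v = 1 ∨ μ v = -1) (h : IsPartner μ ε v w) :
    μ w = 1 := by
  obtain ⟨k, hk, -, h0, hneg, rfl⟩ := h
  have := hneg k hk le_rfl
  rw [arcSum_succ] at h0
  have := hval (v + ε * (k : ZMod (2*n+1)))
  omega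

lemma IsPartner.right_unique {w' : ZMod (2*n+1)} (h : IsPartner μ ε v w)
    (h' : IsPartner μ ε v w') : w = w' := by
  obtain ⟨k, hk, -, h0, hneg, rfl⟩ := h
  obtain ⟨k', hk', -, h0', hneg', rfl⟩ := h'
  rcases lt_trichotomy k k' with h | rfl | h
  · have := hneg' (k + 1) (by omega) h
    omega
  · rfl
  · have := hneg (k' + 1) (by omega) h
    omega

lemma IsPartner.left_unique {v' : ZMod (2*n+1)} (h : IsPartner μ ε v w)
    (h' : IsPartner μ ε v' w) : v = v' := by
  have key : ∀ {k k' : ℕ} {v v' : ZMod (2*n+1)}, k < k' → arcSum μ ε v (k + 1) = 0 →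
      arcSum μ ε v' (k' + 1) = 0 → (∀ j, 1 ≤ j → j ≤ k' → arcSum μ ε v' j < 0) →
      v + ε * (k : ZMod (2*n+1)) = v' + ε * (k' : ZMod (2*n+1)) → False := by
    intro k k' v v' hlt h0 h0' hneg' e
    have hv : v' + ε * ((k' - k : ℕ) : ZMod (2*n+1)) = v := by
      rw [Nat.cast_sub hlt.le]
      linear_combination -e
    rw [show k' + 1 = (k' - k) + (k + 1) by omega, arcSum_add, hv, h0] at h0'
    have := hneg' (k' - k) (by omega) (by omega)
    omega
  obtain ⟨k, hk, -, h0, hneg, rfl⟩ := h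
  obtain ⟨k', hk', -, h0', hneg', e⟩ := h'
  rcases lt_trichotomy k k' with h | rfl | h
  · exact (key h h0 h0' hneg' e).elim
  · exact add_right_cancel e
  · exact (key h h0' h0 hneg e.symm).elim

lemma IsPartner.not_neg (hval : ∀ v, μ v = 1 ∨ μ v = -1) (htot : ∑ x, μ x = 1)
    (h : IsPartner μ 1 v w) : ¬ IsPartner μ (-1) v w := by
  intro h'
  have hv := h.apply_left hval
  have hw := h.apply_right hval
  obtain ⟨k, hk, hk2, h0, -, rfl⟩ := h
  obtain ⟨l, hl, hl2, h0', -, e⟩ := h'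
  have hkl : k + l = 2 * n + 1 := by
    have : ((k + l : ℕ) : ZMod (2*n+1)) = 0 := by
      push_cast
      linear_combination e
    rw [ZMod.natCast_eq_zero_iff] at this
    obtain ⟨c, hc⟩ := this
    have : c = 1 := by
      rcases c with _ | _ | c
      · omega
      · rfl
      · nlinarith
    subst this
    omega
  have hrev := arcSum_reverse (μ := μ) (ε := -1) (v := v) l
  rw [h0', ← e, neg_neg, arcSum_succ] at hrev
  have hwl : v + 1 * (k : ZMod (2*n+1)) + 1 * (l : ZMod (2*n+1)) = v := by
    rw [e]
    ring
  rw [hwl, hv] at hrev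
  have hfull := arcSum_full (ε := 1) (by ring) htot v
  have hsplit := arcSum_add (μ := μ) (ε := 1) (v := v) k l
  rw [hkl, hfull] at hsplit
  rw [arcSum_succ, hw] at h0
  omega

lemma exists_isPartner_of_arcSum_nonpos (hval : ∀ v, μ v = 1 ∨ μ v = -1) (hw : μ w = 1)
    (hk : k ≤ 2 * n) (hs : arcSum μ (-ε) w (k + 1) ≤ 0) : ∃ v, IsPartner μ ε v w := by
  classical
  have hex : ∃ k, arcSum μ (-ε) w (k + 1) ≤ 0 := ⟨k, hs⟩
  have hle : Nat.find hex ≤ 2 * n := (Nat.find_min' hex hs).trans hk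
  have hspec := Nat.find_spec hex
  have hmin : ∀ j, j < Nat.find hex → 0 < arcSum μ (-ε) w (j + 1) := fun j hj =>
    not_le.1 (Nat.find_min hex hj)
  generalize Nat.find hex = m at *
  have hm : 1 ≤ m := by
    rcases Nat.eq_zero_or_pos m with rfl | h
    · rw [zero_add, arcSum_one] at hspec
      omega
    · exact h
  have hpos : ∀ j, 1 ≤ j → j ≤ m → 0 < arcSum μ (-ε) w j := fun j h1 h2 => by
    have := hmin (j - 1) (by omega)
    rwa [Nat.sub_add_cancel h1] at this
  have h0 : arcSum μ (-ε) w (m + 1) = 0 := by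
    have h1 := hpos m hm le_rfl
    rw [arcSum_succ] at hspec ⊢
    rcases hval (w + -ε * (m : ZMod (2*n+1))) with h | h <;> omega
  refine ⟨w + -ε * (m : ZMod (2*n+1)), m, hm, hle, ?_, ?_, by ring⟩
  · have := arcSum_reverse (μ := μ) (ε := -ε) (v := w) m
    rwa [neg_neg, h0] at this
  · intro j h1 h2
    have hsplit := h0
    rw [show m + 1 = (m + 1 - j) + j by omega, arcSum_add] at hsplit
    have hrev := arcSum_reverse (μ := μ) (ε := -ε)
      (v := w + -ε * ((m + 1 - j : ℕ) : ZMod (2*n+1))) (j - 1)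
    have hv : w + -ε * ((m + 1 - j : ℕ) : ZMod (2*n+1)) + -ε * ((j - 1 : ℕ) : ZMod (2*n+1))
        = w + -ε * (m : ZMod (2*n+1)) := by
      rw [add_assoc, ← mul_add, ← Nat.cast_add, show m + 1 - j + (j - 1) = m by omega]
    rw [neg_neg, Nat.sub_add_cancel h1, hv] at hrev
    have := hpos (m + 1 - j) (by omega) (by omega)
    omega

lemma exists_isPartner_or (hn : 0 < n) (hval : ∀ v, μ v = 1 ∨ μ v = -1)
    (htot : ∑ x, μ x = 1) (hw : μ w = 1) :
    (∃ v, IsPartner μ 1 v w) ∨ ∃ v, IsPartner μ (-1) v w := by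
  rcases hval (w + -1 * ((1 : ℕ) : ZMod (2*n+1))) with h | h
  · right
    refine exists_isPartner_of_arcSum_nonpos hval hw (k := 2 * n - 1) (by omega) ?_
    have hfull := arcSum_full (ε := 1) (by ring) htot w
    have hlast : w + 1 * ((2 * n : ℕ) : ZMod (2*n+1)) = w + -1 * ((1 : ℕ) : ZMod (2*n+1)) := by
      have : ((2 * n + 1 : ℕ) : ZMod (2*n+1)) = 0 := ZMod.natCast_self _
      push_cast at this ⊢
      linear_combination this
    rw [arcSum_succ, hlast, h] at hfull
    rw [neg_neg, Nat.sub_add_cancel (by omega)]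
    omega
  · left
    refine exists_isPartner_of_arcSum_nonpos hval hw (k := 1) (by omega) ?_
    rw [arcSum_succ, arcSum_one, hw, h]
    norm_num

lemma isPartner_iff_least (hval : ∀ v, μ v = 1 ∨ μ v = -1) (hv : μ v = -1) :
    IsPartner μ ε v w ↔ ∃ k ∈ Icc 1 (2*n),
      (μ (v + ε * (k : ZMod (2*n+1))) = 1 ∧ arcSum μ ε v k = -1) ∧
      (∀ j ∈ Icc 1 (2*n), j < k →
        ¬ (μ (v + ε * (j : ZMod (2*n+1))) = 1 ∧ arcSum μ ε v j = -1)) ∧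
      w = v + ε * (k : ZMod (2*n+1)) := by
  constructor
  · intro h
    have hw := h.apply_right hval
    obtain ⟨k, hk, hk2, h0, hneg, rfl⟩ := h
    refine ⟨k, mem_Icc.2 ⟨hk, hk2⟩, ⟨hw, ?_⟩, ?_, rfl⟩
    · rw [arcSum_succ, hw] at h0
      omega
    · rintro j hj hjk ⟨h1, h2⟩
      have := hneg (j + 1) (by omega) hjk
      rw [arcSum_succ, h1, h2] at this
      omega
  · rintro ⟨k, hk, ⟨h1, h2⟩, hmin, rfl⟩
    obtain ⟨hk, hk2⟩ := mem_Icc.1 hk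
    refine ⟨k, hk, hk2, by rw [arcSum_succ, h1, h2]; norm_num, ?_, rfl⟩
    intro j hj
    induction j, hj using Nat.le_induction with
    | base => intro _; rw [arcSum_one, hv]; norm_num
    | succ j hj ih =>
      intro hjk
      have hlt := ih (by omega)
      have hng := hmin j (mem_Icc.2 ⟨hj, by omega⟩) hjk
      rw [arcSum_succ]
      rcases hval (v + ε * (j : ZMod (2*n+1))) with h | h
      · have : arcSum μ ε v j ≠ -1 := fun h' => hng ⟨h, h'⟩
        omega
      · omega

lemma arcBalanced_iff (hval : ∀ v, μ v = 1 ∨ μ v = -1) (hk : 1 ≤ k) :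
    ArcBalanced n μ v k ↔ arcSum μ 1 v k = μ v := by
  obtain ⟨m, rfl⟩ := Nat.exists_eq_add_of_le' hk
  have hsum : arcSum μ 1 v (m + 1) = μ v + ∑ i ∈ Icc 1 m, μ (v + (i : ZMod (2*n+1))) := by
    rw [arcSum, sum_range_succ', add_comm, range_eq_Ico, sum_Ico_add' (fun i : ℕ => μ (v + 1 * (i : ZMod (2*n+1)))) 0 m 1]
    simp only [one_mul, Nat.cast_zero, add_zero, zero_add]
    rfl
  have hcard : ∑ i ∈ Icc 1 m, μ (v + (i : ZMod (2*n+1))) =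
      (((Icc 1 m).filter fun i : ℕ => μ (v + (i : ZMod (2*n+1))) = 1).card : ℤ) -
      (((Icc 1 m).filter fun i : ℕ => μ (v + (i : ZMod (2*n+1))) = -1).card : ℤ) := by
    rw [card_filter, card_filter]
    push_cast
    rw [← sum_sub_distrib]
    refine sum_congr rfl fun i _ => ?_
    rcases hval (v + (i : ZMod (2*n+1))) with h | h <;> simp [h]
  rw [ArcBalanced, Nat.add_sub_cancel, hsum, hcard]
  omega

lemma isAPartner_iff (hval : ∀ v, μ v = 1 ∨ μ v = -1) (hv : μ v = -1) :
    IsAPartner n μ v w ↔ IsPartner μ 1 v w := by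
  rw [isPartner_iff_least hval hv, IsAPartner]
  have hgood : ∀ k, 1 ≤ k → (AGood n μ v k ↔
      (μ (v + 1 * (k : ZMod (2*n+1))) = 1 ∧ arcSum μ 1 v k = -1)) := fun k hk => by
    rw [AGood, arcBalanced_iff hval hk, hv, one_mul]
  refine exists_congr fun k => and_congr_right fun hk => ?_
  rw [hgood k (mem_Icc.1 hk).1, one_mul]
  refine and_congr_right fun _ => and_congr_left fun _ => ?_
  exact forall₂_congr fun j hj => by rw [hgood j (mem_Icc.1 hj).1]

lemma isBPartner_iff (hval : ∀ v, μ v = 1 ∨ μ v = -1) (hv : μ v = -1) :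
    IsBPartner n μ v w ↔ IsPartner μ (-1) v w := by
  rw [isPartner_iff_least hval hv, IsBPartner]
  have hsub : ∀ k : ℕ, v + -1 * (k : ZMod (2*n+1)) = v - k := fun k => by ring
  have hgood : ∀ k, 1 ≤ k → (BGood n μ v k ↔
      (μ (v + -1 * (k : ZMod (2*n+1))) = 1 ∧ arcSum μ (-1) v k = -1)) := fun k hk => by
    rw [BGood, arcBalanced_iff hval hk, hsub]
    refine and_congr_right fun h => ?_
    have hrev := arcSum_reverse (μ := μ) (ε := -1) (v := v) k
    rw [neg_neg, hsub, arcSum_succ, arcSum_succ, hsub, h, one_mul, sub_add_cancel, hv] at hrev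
    rw [h]
    omega
  refine exists_congr fun k => and_congr_right fun hk => ?_
  rw [hgood k (mem_Icc.1 hk).1, hsub]
  refine and_congr_right fun _ => and_congr_left fun _ => ?_
  exact forall₂_congr fun j hj => by rw [hgood j (mem_Icc.1 hj).1]

lemma existsUnique_not_isPartner (hval : ∀ v, μ v = 1 ∨ μ v = -1) (hε : ε * ε = 1)
    (htot : ∑ x, μ x = 1)
    (hplus : (univ.filter fun v : ZMod (2*n+1) => μ v = 1).card = n + 1)
    (hminus : (univ.filter fun v : ZMod (2*n+1) => μ v = -1).card = n) :
    ∃! w, μ w = 1 ∧ ¬ ∃ v, IsPartner μ ε v w := by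
  classical
  have hex : ∀ v, ∃ w, μ v = -1 → IsPartner μ ε v w := fun v => by
    by_cases hv : μ v = -1
    · obtain ⟨w, hw⟩ := exists_isPartner hval hε htot hv
      exact ⟨w, fun _ => hw⟩
    · exact ⟨v, fun h => absurd h hv⟩
  choose f hf using hex
  set M := univ.filter fun v : ZMod (2*n+1) => μ v = -1 with hM
  set P := univ.filter fun v : ZMod (2*n+1) => μ v = 1 with hP
  have hmemM : ∀ {v}, v ∈ M ↔ μ v = -1 := by simp [hM]
  have hmemP : ∀ {v}, v ∈ P ↔ μ v = 1 := by simp [hP]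
  have himage : M.image f ⊆ P := by
    intro w hw
    obtain ⟨v, hv, rfl⟩ := mem_image.1 hw
    exact hmemP.2 ((hf v (hmemM.1 hv)).apply_right hval)
  have hinj : Set.InjOn f M := fun v hv v' hv' e =>
    (hf v (hmemM.1 hv)).left_unique (e ▸ hf v' (hmemM.1 hv'))
  have hcard : (P \ M.image f).card = 1 := by
    rw [card_sdiff_of_subset himage, card_image_of_injOn hinj, hplus, hminus]
    omega
  have hmem : ∀ w, w ∈ P \ M.image f ↔ μ w = 1 ∧ ¬ ∃ v, IsPartner μ ε v w := fun w => by
    rw [mem_sdiff, hmemP, mem_image]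
    refine and_congr_right fun _ => not_congr (exists_congr fun v => ?_)
    rw [hmemM]
    exact ⟨fun ⟨hv, e⟩ => e ▸ hf v hv, fun h => ⟨h.apply_left hval,
      (hf v (h.apply_left hval)).right_unique h⟩⟩
  obtain ⟨w, hw⟩ := card_eq_one.1 hcard
  refine ⟨w, (hmem w).1 (by simp [hw]), fun w' hw' => ?_⟩
  simpa [hw] using (hmem w').2 hw'

lemma adj_iff (hval : ∀ v, μ v = 1 ∨ μ v = -1) (x y : ZMod (2*n+1)) :
    (G n μ).Adj x y ↔ (IsPartner μ 1 x y ∨ IsPartner μ (-1) x y) ∨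
      (IsPartner μ 1 y x ∨ IsPartner μ (-1) y x) := by
  have key : ∀ x y, (μ x = -1 ∧ (IsAPartner n μ x y ∨ IsBPartner n μ x y)) ↔
      (IsPartner μ 1 x y ∨ IsPartner μ (-1) x y) := fun x y => by
    constructor
    · rintro ⟨hx, h⟩
      rwa [isAPartner_iff hval hx, isBPartner_iff hval hx] at h
    · intro h
      have hx : μ x = -1 := h.elim (·.apply_left hval) (·.apply_left hval)
      rw [isAPartner_iff hval hx, isBPartner_iff hval hx]
      exact ⟨hx, h⟩
  have hne : ∀ x y, (IsPartner μ 1 x y ∨ IsPartner μ (-1) x y) → x ≠ y := by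
    rintro x y h rfl
    have h1 : μ x = -1 := h.elim (·.apply_left hval) (·.apply_left hval)
    have h2 : μ x = 1 := h.elim (·.apply_right hval) (·.apply_right hval)
    omega
  rw [G, SimpleGraph.fromRel_adj, key, key]
  exact ⟨fun h => h.2, fun h => ⟨h.elim (hne x y) fun h => (hne y x h).symm, h⟩⟩

lemma degree_eq_ncard (w : ZMod (2*n+1)) :
    (G n μ).degree w = {v | (G n μ).Adj w v}.ncard := by
  rw [← SimpleGraph.card_neighborSet_eq_degree, ← Nat.card_eq_fintype_card]
  rfl

lemma degree_eq_one_iff (hn : 0 < n) (hval : ∀ v, μ v = 1 ∨ μ v = -1)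
    (htot : ∑ x, μ x = 1) (w : ZMod (2*n+1)) :
    (G n μ).degree w = 1 ↔ μ w = 1 ∧
      ((¬ ∃ v, IsPartner μ 1 v w) ∨ ¬ ∃ v, IsPartner μ (-1) v w) := by
  rw [degree_eq_ncard]
  simp only [adj_iff hval]
  rcases hval w with hw | hw
  · have hout : ∀ ε v, ¬ IsPartner μ ε w v := fun ε v h => by
      have := h.apply_left hval
      omega
    simp only [hout, hw, false_or, true_and]
    by_cases hA : ∃ v, IsPartner μ 1 v w <;> by_cases hB : ∃ v, IsPartner μ (-1) v w
    · obtain ⟨a, ha⟩ := hA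
      obtain ⟨b, hb⟩ := hB
      have hab : a ≠ b := by
        rintro rfl
        exact ha.not_neg hval htot hb
      have hset : {v | IsPartner μ 1 v w ∨ IsPartner μ (-1) v w} = {a, b} := by
        ext v
        exact ⟨Or.imp (·.left_unique ha) (·.left_unique hb),
          by rintro (rfl | rfl); exacts [Or.inl ha, Or.inr hb]⟩
      rw [hset, Set.ncard_pair hab]
      simpa using ⟨⟨a, ha⟩, ⟨b, hb⟩⟩
    · simp only [hB, not_false_eq_true, or_true, iff_true]
      obtain ⟨a, ha⟩ := hA
      rw [Set.ncard_eq_one]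
      refine ⟨a, Set.ext fun v => ⟨?_, by rintro rfl; exact Or.inl ha⟩⟩
      rintro (h | h)
      exacts [h.left_unique ha, (hB ⟨v, h⟩).elim]
    · simp only [hA, not_false_eq_true, true_or, iff_true]
      obtain ⟨b, hb⟩ := hB
      rw [Set.ncard_eq_one]
      refine ⟨b, Set.ext fun v => ⟨?_, by rintro rfl; exact Or.inr hb⟩⟩
      rintro (h | h)
      exacts [(hA ⟨v, h⟩).elim, h.left_unique hb]
    · exact ((exists_isPartner_or hn hval htot hw).elim hA hB).elim
  · have hin : ∀ ε v, ¬ IsPartner μ ε v w := fun ε v h => by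
      have := h.apply_right hval
      omega
    obtain ⟨a, ha⟩ := exists_isPartner (ε := 1) hval (by ring) htot hw
    obtain ⟨b, hb⟩ := exists_isPartner (ε := -1) hval (by ring) htot hw
    have hab : a ≠ b := by
      rintro rfl
      exact ha.not_neg hval htot hb
    have hset : {v | IsPartner μ 1 w v ∨ IsPartner μ (-1) w v} = {a, b} := by
      ext v
      exact ⟨Or.imp (·.right_unique ha) (·.right_unique hb),
        by rintro (rfl | rfl); exacts [Or.inl ha, Or.inr hb]⟩
    simp only [hin, or_false, hset, Set.ncard_pair hab, hw]
    norm_num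

end Cancellation

theorem degree_one_iff (n : ℕ) (μ : ZMod (2*n+1) → ℤ)
    (hn : 0 < n)
    (hval : ∀ v, μ v = 1 ∨ μ v = -1)
    (hplus : (Finset.univ.filter fun v : ZMod (2*n+1) => μ v = 1).card = n + 1)
    (hminus : (Finset.univ.filter fun v : ZMod (2*n+1) => μ v = -1).card = n) :
    (∀ w : ZMod (2*n+1), (G n μ).degree w = 1 ↔
      (μ w = 1 ∧ ((¬ ∃ v : ZMod (2*n+1), μ v = -1 ∧ IsAPartner n μ v w) ∨
        (¬ ∃ v : ZMod (2*n+1), μ v = -1 ∧ IsBPartner n μ v w)))) ∧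
    (∀ w w' : ZMod (2*n+1),
      (μ w = 1 ∧ ¬ ∃ v : ZMod (2*n+1), μ v = -1 ∧ IsAPartner n μ v w) →
      (μ w' = 1 ∧ ¬ ∃ v : ZMod (2*n+1), μ v = -1 ∧ IsBPartner n μ v w') → w ≠ w') ∧
    {w : ZMod (2*n+1) | (G n μ).degree w = 1}.ncard = 2 := by
  have htot : ∑ x, μ x = 1 := by
    have h : ∀ x, μ x = (if μ x = 1 then 1 else 0) - (if μ x = -1 then 1 else 0) := fun x => by
      rcases hval x with h | h <;> simp [h]
    rw [sum_congr rfl fun x _ => h x, sum_sub_distrib, sum_boole, sum_boole, hplus, hminus]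
    push_cast
    ring
  have hA : ∀ w, (∃ v, μ v = -1 ∧ IsAPartner n μ v w) ↔ ∃ v, Cancellation.IsPartner μ 1 v w :=
    fun w => exists_congr fun v =>
      ⟨fun h => (Cancellation.isAPartner_iff hval h.1).1 h.2, fun h =>
        ⟨h.apply_left hval, (Cancellation.isAPartner_iff hval (h.apply_left hval)).2 h⟩⟩
  have hB : ∀ w, (∃ v, μ v = -1 ∧ IsBPartner n μ v w) ↔
      ∃ v, Cancellation.IsPartner μ (-1) v w :=
    fun w => exists_congr fun v =>
      ⟨fun h => (Cancellation.isBPartner_iff hval h.1).1 h.2, fun h =>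
        ⟨h.apply_left hval, (Cancellation.isBPartner_iff hval (h.apply_left hval)).2 h⟩⟩
  have hdeg := Cancellation.degree_eq_one_iff hn hval htot
  have hne : ∀ w w', (μ w = 1 ∧ ¬ ∃ v, Cancellation.IsPartner μ 1 v w) →
      (μ w' = 1 ∧ ¬ ∃ v, Cancellation.IsPartner μ (-1) v w') → w ≠ w' := by
    rintro w _ ⟨hw, ha⟩ ⟨-, hb⟩ rfl
    exact (Cancellation.exists_isPartner_or hn hval htot hw).elim ha hb
  simp only [hA, hB]
  refine ⟨hdeg, hne, ?_⟩
  obtain ⟨a, ha, ha'⟩ := Cancellation.existsUnique_not_isPartner (ε := 1) hval (by ring) htot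
    hplus hminus
  obtain ⟨b, hb, hb'⟩ := Cancellation.existsUnique_not_isPartner (ε := -1) hval (by ring) htot
    hplus hminus
  rw [Set.ncard_eq_two]
  refine ⟨a, b, hne a b ha hb, Set.ext fun w => ?_⟩
  rw [Set.mem_ofPred_eq, hdeg, and_or_left]
  exact ⟨Or.imp (ha' w) (hb' w), by rintro (rfl | rfl); exacts [Or.inl ha, Or.inr hb]⟩
end

section
/- For every vertex v with μ(v) = −1, if the A-partner of v is v+k with k ≥ 2, then μ(v+1) = −1 and μ(v+k−1) = +1 (the arc between v and its A-partner begins with a −1 vertex and ends with a +1 vertex). -/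
open Finset

theorem arcBalanced_succ_iff_sum_eq_zero {n : ℕ} {μ : ZMod (2*n+1) → ℤ}
    (hval : ∀ v, μ v = 1 ∨ μ v = -1) (v : ZMod (2*n+1)) (m : ℕ) :
    ArcBalanced n μ v (m + 1) ↔
      ∑ i ∈ Finset.Icc 1 m, μ (v + (i : ZMod (2*n+1))) = 0 := by
  have hsum : ∑ i ∈ Finset.Icc 1 m, μ (v + (i : ZMod (2*n+1))) =
      (((Finset.Icc 1 m).filter fun i : ℕ => μ (v + (i : ZMod (2*n+1))) = 1).card : ℤ) -
      ((Finset.Icc 1 m).filter fun i : ℕ => μ (v + (i : ZMod (2*n+1))) = -1).card := by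
    rw [Finset.card_filter, Finset.card_filter]
    push_cast
    rw [← Finset.sum_sub_distrib]
    refine Finset.sum_congr rfl fun i _ => ?_
    rcases hval (v + (i : ZMod (2*n+1))) with h | h <;> simp [h]
  rw [hsum, ArcBalanced, Nat.add_sub_cancel]
  omega

/-- Before the first good length, every partial sum of labels along the arc is nonpositive. -/
theorem sum_arc_nonpos {n : ℕ} {μ : ZMod (2*n+1) → ℤ}
    (hval : ∀ v, μ v = 1 ∨ μ v = -1) (v : ZMod (2*n+1)) {m : ℕ}
    (hbad : ∀ j ∈ Finset.Icc 1 m, ¬ AGood n μ v j) :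
    ∑ i ∈ Finset.Icc 1 m, μ (v + (i : ZMod (2*n+1))) ≤ 0 := by
  induction m with
  | zero => simp
  | succ m ih =>
    have hle := ih fun j hj => hbad j (Finset.Icc_subset_Icc_right m.le_succ hj)
    rw [Finset.sum_Icc_succ_top (by omega)]
    rcases hval (v + ((m + 1 : ℕ) : ZMod (2*n+1))) with h | h
    · have hne : ∑ i ∈ Finset.Icc 1 m, μ (v + (i : ZMod (2*n+1))) ≠ 0 := fun h0 =>
        hbad (m + 1) (by simp) ⟨h, (arcBalanced_succ_iff_sum_eq_zero hval v m).2 h0⟩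
      omega
    · omega

theorem arc_endpoints (n : ℕ) (μ : ZMod (2*n+1) → ℤ)
    (hn : 0 < n)
    (hval : ∀ v, μ v = 1 ∨ μ v = -1)
    (hplus : (Finset.univ.filter fun v : ZMod (2*n+1) => μ v = 1).card = n + 1)
    (hminus : (Finset.univ.filter fun v : ZMod (2*n+1) => μ v = -1).card = n) :
    ∀ (v : ZMod (2*n+1)) (k : ℕ), μ v = -1 → k ∈ Finset.Icc 1 (2*n) → AGood n μ v k →
      (∀ j ∈ Finset.Icc 1 (2*n), j < k → ¬ AGood n μ v j) → 2 ≤ k →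
      μ (v + 1) = -1 ∧ μ (v + ((k - 1 : ℕ) : ZMod (2*n+1))) = 1 := by
  intro v k _ hk hgood hmin h2
  rw [Finset.mem_Icc] at hk
  have hbad : ∀ j ∈ Finset.Icc 1 (k - 1), ¬ AGood n μ v j := fun j hj => by
    rw [Finset.mem_Icc] at hj
    exact hmin j (Finset.mem_Icc.2 (by omega)) (by omega)
  constructor
  · refine (hval (v + 1)).resolve_left fun h => hbad 1 (Finset.mem_Icc.2 (by omega)) ?_
    exact ⟨by simpa using h, by simp [ArcBalanced]⟩
  · obtain ⟨m, rfl⟩ : ∃ m, k = m + 1 + 1 := ⟨k - 2, by omega⟩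
    rw [Nat.add_sub_cancel] at hbad ⊢
    have hle := sum_arc_nonpos hval v fun j hj =>
      hbad j (Finset.Icc_subset_Icc_right m.le_succ hj)
    have hzero := (arcBalanced_succ_iff_sum_eq_zero hval v (m + 1)).1 hgood.2
    rw [Finset.sum_Icc_succ_top (by omega)] at hzero
    refine (hval _).resolve_right fun h => ?_
    omega
end
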